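/- arXiv:0912.4913 — 2 statements merged into one kernel-verified Lean document; each statement's English description precedes it below -/
import Mathlib

section
/- For every real number q with 0 < q < 1, one has 1/R(q)⁵ − 11 − R(q)⁵ = f(−q)⁶ / (q · f(−q⁵)⁶), where R(q) = q^{1/5} ∏_{n=1}^∞ (1 − qⁿ)^{χ₅(n)} and f(−q) = ∏_{n=1}^∞ (1 − qⁿ). -/
/-- The Legendre symbol modulo 5 as an integer-valued function. -/
def chi5 (n : ℕ) : ℤ :=
  if n % 5 = 1 ∨ n % 5 = 4 then 1
  else if n % 5 = 2 ∨ n % 5 = 3 then -1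
  else 0

/-- The Rogers–Ramanujan continued fraction, given by its product representation
`R(q) = q^{1/5} ∏_{n=1}^∞ (1 - q^n)^{χ₅(n)}`. -/
noncomputable def RR (q : ℝ) : ℝ :=
  q ^ ((1 : ℝ) / 5) * ∏' n : ℕ, (1 - q ^ (n + 1)) ^ chi5 (n + 1)

/-- Ramanujan's function `f(-q) = ∏_{n=1}^∞ (1 - q^n)`. -/
noncomputable def ramanujanF (q : ℝ) : ℝ :=
  ∏' n : ℕ, (1 - q ^ (n + 1))

open Filter Topology

/-- The `q`-Pochhammer symbol `(z; q)_∞`. -/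
noncomputable def qPoch (q z : ℂ) : ℂ := ∏' n : ℕ, (1 - z * q ^ n)

lemma multipliable_qPoch {q : ℂ} (hq : ‖q‖ < 1) (z : ℂ) :
    Multipliable fun n : ℕ ↦ 1 - z * q ^ n := by
  have : Summable fun n : ℕ ↦ ‖-(z * q ^ n)‖ := by
    simpa using (summable_geometric_of_lt_one (norm_nonneg q) hq).mul_left ‖z‖
  simpa [sub_eq_add_neg] using multipliable_one_add_of_summable this

lemma tendsto_qPoch {q : ℂ} (hq : ‖q‖ < 1) (z : ℂ) :
    Tendsto (fun N : ℕ ↦ ∏ n ∈ Finset.range N, (1 - z * q ^ n)) atTop (𝓝 (qPoch q z)) :=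
  (multipliable_qPoch hq z).tendsto_prod_tprod_nat

lemma one_sub_mul_pow_ne_zero {q : ℂ} (hq : ‖q‖ < 1) (n : ℕ) : 1 - q * q ^ n ≠ 0 := fun h ↦ by
  have h1 : q ^ (n + 1) = 1 := by linear_combination -h
  have h2 := pow_lt_one₀ (norm_nonneg q) hq (Nat.succ_ne_zero n)
  rw [← norm_pow, h1] at h2
  simp at h2

lemma qPoch_self_ne_zero {q : ℂ} (hq : ‖q‖ < 1) : qPoch q q ≠ 0 := by
  have hs : Summable fun n : ℕ ↦ ‖-(q * q ^ n)‖ := by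
    simpa using (summable_geometric_of_lt_one (norm_nonneg q) hq).mul_left ‖q‖
  have hne (n : ℕ) : 1 + -(q * q ^ n) ≠ 0 := by
    simpa only [sub_eq_add_neg] using one_sub_mul_pow_ne_zero hq n
  simpa [qPoch, sub_eq_add_neg] using tprod_one_add_ne_zero_of_summable hne hs

lemma qPoch_eq_mul {q : ℂ} (hq : ‖q‖ < 1) (z : ℂ) :
    qPoch q z = (1 - z) * qPoch q (z * q) := by
  have h : Multipliable fun n : ℕ ↦ 1 - z * q ^ (n + 1) := by
    simpa only [pow_succ', mul_assoc] using multipliable_qPoch hq (z * q)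
  simp only [qPoch, tprod_eq_zero_mul' (f := fun n : ℕ ↦ 1 - z * q ^ n) h,
    pow_zero, mul_one, pow_succ', mul_assoc]

/-- `(z; q)_∞` splits along residue classes modulo `5`. -/
lemma qPoch_dissect {q : ℂ} (hq : ‖q‖ < 1) (z : ℂ) :
    qPoch q z = ∏ r ∈ Finset.range 5, qPoch (q ^ 5) (z * q ^ r) := by
  have hq5 : ‖q ^ 5‖ < 1 := by
    rw [norm_pow]; exact pow_lt_one₀ (norm_nonneg q) hq (by norm_num)
  have h1 := (tendsto_qPoch hq z).comp
    (tendsto_id.const_mul_atTop' (show 0 < 5 by norm_num) : Tendsto (fun n : ℕ ↦ 5 * n) _ _)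
  have h2 := tendsto_finsetProd (Finset.range 5) fun r _ ↦ tendsto_qPoch hq5 (z * q ^ r)
  refine tendsto_nhds_unique h1 (h2.congr fun N ↦ ?_)
  induction N with
  | zero => simp
  | succ N ih =>
    simp only [Finset.prod_range_succ _ N, Finset.prod_mul_distrib, ih, Function.comp_apply]
    simp only [Nat.mul_succ, Finset.prod_range_succ, Finset.prod_range_zero, one_mul]
    ring

lemma prod_one_sub_of_cyclotomic {ζ : ℂ} (hζ : 1 + ζ + ζ ^ 2 + ζ ^ 3 + ζ ^ 4 = 0) (w : ℂ) :
    (1 - w) * (1 - ζ * w) * (1 - ζ ^ 2 * w) * (1 - ζ ^ 3 * w) * (1 - ζ ^ 4 * w) = 1 - w ^ 5 := by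
  grind

lemma qPoch_mul_roots {q ζ : ℂ} (hq : ‖q‖ < 1) (hζ : 1 + ζ + ζ ^ 2 + ζ ^ 3 + ζ ^ 4 = 0) (z : ℂ) :
    qPoch q z * qPoch q (ζ * z) * qPoch q (ζ ^ 2 * z) * qPoch q (ζ ^ 3 * z) * qPoch q (ζ ^ 4 * z) =
      qPoch (q ^ 5) (z ^ 5) := by
  have hq5 : ‖q ^ 5‖ < 1 := by
    rw [norm_pow]; exact pow_lt_one₀ (norm_nonneg q) hq (by norm_num)
  have h := ((((tendsto_qPoch hq z).mul (tendsto_qPoch hq (ζ * z))).mul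
    (tendsto_qPoch hq (ζ ^ 2 * z))).mul (tendsto_qPoch hq (ζ ^ 3 * z))).mul
    (tendsto_qPoch hq (ζ ^ 4 * z))
  refine tendsto_nhds_unique h ((tendsto_qPoch hq5 (z ^ 5)).congr fun N ↦ ?_)
  simp only [← Finset.prod_mul_distrib]
  refine Finset.prod_congr rfl fun n _ ↦ ?_
  have := prod_one_sub_of_cyclotomic hζ (z * q ^ n)
  simp only [mul_assoc] at this ⊢
  rw [this]; ring

/-- `∏_k (ζᵏ x; ζᵏ x)_∞` over fifth roots of unity. -/
lemma qPoch_self_mul_roots {x ζ : ℂ} (hx : ‖x‖ < 1) (hζ : 1 + ζ + ζ ^ 2 + ζ ^ 3 + ζ ^ 4 = 0)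
    (hζn : ‖ζ‖ = 1) :
    qPoch x x * qPoch (ζ * x) (ζ * x) * qPoch (ζ ^ 2 * x) (ζ ^ 2 * x) *
      qPoch (ζ ^ 3 * x) (ζ ^ 3 * x) * qPoch (ζ ^ 4 * x) (ζ ^ 4 * x) *
      qPoch ((x ^ 5) ^ 5) ((x ^ 5) ^ 5) = qPoch (x ^ 5) (x ^ 5) ^ 6 := by
  have hx5 : ‖x ^ 5‖ < 1 := by
    rw [norm_pow]; exact pow_lt_one₀ (norm_nonneg x) hx (by norm_num)
  have hζ5 : ζ ^ 5 = 1 := by linear_combination (ζ - 1) * hζ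
  have hn (k : ℕ) : ‖ζ ^ k * x‖ < 1 := by simpa [hζn] using hx
  have key (k : ℕ) : qPoch (ζ ^ k * x) (ζ ^ k * x) =
      ∏ r ∈ Finset.range 5, qPoch (x ^ 5) (ζ ^ (k * (r + 1)) * x ^ (r + 1)) := by
    rw [qPoch_dissect (hn k)]
    refine Finset.prod_congr rfl fun r _ ↦ ?_
    congr 1
    · rw [mul_pow, ← pow_mul, mul_comm k, pow_mul, hζ5, one_pow, one_mul]
    · rw [pow_mul]; ring
  have h0 := key 0
  have h1 := key 1
  have h2 := key 2
  have h3 := key 3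
  have h4 := key 4
  have hQ := qPoch_dissect hx5 (x ^ 5)
  have hm (w : ℂ) := qPoch_mul_roots hx5 hζ w
  have e (n : ℕ) : ζ ^ n = ζ ^ (n % 5) := by
    conv_lhs => rw [← Nat.div_add_mod n 5, pow_add, pow_mul, hζ5, one_pow, one_mul]
  have m1 := hm x
  have m2 := hm (x ^ 2)
  have m3 := hm (x ^ 3)
  have m4 := hm (x ^ 4)
  simp only [Finset.prod_range_succ, Finset.prod_range_zero, one_mul, e (_ * _)] at h0 h1 h2 h3 h4 hQ
  norm_num [hζ5] at h0 h1 h2 h3 h4 hQ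
  rw [show x ^ 5 * x ^ 5 = (x ^ 2) ^ 5 by ring, show x ^ 5 * (x ^ 5) ^ 2 = (x ^ 3) ^ 5 by ring,
    show x ^ 5 * (x ^ 5) ^ 3 = (x ^ 4) ^ 5 by ring,
    show x ^ 5 * (x ^ 5) ^ 4 = (x ^ 5) ^ 5 by ring, ← m1, ← m2, ← m3, ← m4] at hQ
  rw [h0, h1, h2, h3, h4]
  generalize qPoch (x ^ 5) (x ^ 5) = F at *
  rw [pow_succ F 5]
  nth_rw 7 [hQ]
  ring

/-- The Jacobi theta product `(z; q)_∞ (q / z; q)_∞ (q; q)_∞`. -/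
noncomputable def thetaProd (q z : ℂ) : ℂ := qPoch q z * qPoch q (q / z) * qPoch q q

/-- `1 / (q; q)_m`, extended by zero to negative `m`. -/
noncomputable def invPoch (q : ℂ) (m : ℤ) : ℂ :=
  if m < 0 then 0 else (∏ i ∈ Finset.range m.toNat, (1 - q * q ^ i))⁻¹

lemma invPoch_sub_one {q : ℂ} (hq : ‖q‖ < 1) (m : ℤ) :
    invPoch q (m - 1) = (1 - q ^ m) * invPoch q m := by
  rcases lt_trichotomy m 0 with h | rfl | h
  · simp [invPoch, h, show m < 1 by omega]
  · simp [invPoch]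
  · obtain ⟨n, rfl⟩ : ∃ n : ℕ, m = n + 1 := ⟨(m - 1).toNat, by omega⟩
    have h1 : ((n : ℤ) + 1).toNat = n + 1 := by omega
    have h2 : ¬ ((n : ℤ) + 1 < 0) := by omega
    have h3 : (q : ℂ) ^ ((n : ℤ) + 1) = q * q ^ n := by
      rw [← pow_succ']; exact_mod_cast zpow_natCast q (n + 1)
    have := one_sub_mul_pow_ne_zero hq n
    have h4 : ¬ ((n : ℤ) < 0) := by omega
    simp only [invPoch, h1, h2, h3, h4, add_sub_cancel_right, Int.toNat_natCast, if_false,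
      Finset.prod_range_succ]
    field_simp

lemma tendsto_invPoch {q : ℂ} (hq : ‖q‖ < 1) :
    Tendsto (invPoch q) atTop (𝓝 (qPoch q q)⁻¹) := by
  have h := ((tendsto_qPoch hq q).inv₀ (qPoch_self_ne_zero hq)).comp
    (f := Int.toNat) (x := atTop) (tendsto_atTop.2 fun b ↦ by
      filter_upwards [eventually_ge_atTop (b : ℤ)] with a ha using by omega)
  refine h.congr' ?_
  filter_upwards [eventually_ge_atTop 0] with m hm
  simp [invPoch, not_lt.2 hm]

lemma exists_norm_invPoch_le {q : ℂ} (hq : ‖q‖ < 1) : ∃ C, ∀ m, ‖invPoch q m‖ ≤ C := by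
  have h := ((tendsto_qPoch hq q).inv₀ (qPoch_self_ne_zero hq)).norm.bddAbove_range
  obtain ⟨C, hC⟩ := h
  have hC' (n : ℕ) := hC ⟨n, rfl⟩
  refine ⟨C, fun m ↦ ?_⟩
  unfold invPoch
  split_ifs
  · simpa using (norm_nonneg _).trans (hC' 0)
  · exact hC' _

/-- The term `(-1)ᵏ q^{k(k-1)/2} zᵏ` of the theta series. -/
noncomputable def thetaTerm (q z : ℂ) (k : ℤ) : ℂ := (-1) ^ k * q ^ (k * (k - 1) / 2) * z ^ k

lemma thetaTerm_add_one {q z : ℂ} (hq0 : q ≠ 0) (hz : z ≠ 0) (k : ℤ) :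
    thetaTerm q z (k + 1) = -(z * q ^ k) * thetaTerm q z k := by
  have : (k + 1) * (k + 1 - 1) / 2 = k * (k - 1) / 2 + k := by
    rw [show (k + 1) * (k + 1 - 1) = k * (k - 1) + k * 2 by ring,
      Int.add_mul_ediv_right _ _ (by simp)]
  rw [thetaTerm, this, thetaTerm, zpow_add₀ hq0, zpow_add_one₀ hz, zpow_add_one₀ (by simp)]
  ring

lemma hasSum_of_eq {ι : Type*} {f g : ι → ℂ} {a b : ℂ} (hf : HasSum f a) (hg : ∀ k, g k = f k)
    (hb : b = a) : HasSum g b := by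
  rwa [hb, funext hg]

lemma hasSum_finite_triple {q z : ℂ} (hq0 : q ≠ 0) (hq : ‖q‖ < 1) (hz : z ≠ 0) (n : ℕ) :
    HasSum (fun k : ℤ ↦ thetaTerm q z k * (invPoch q (n - k) * invPoch q (n + k)))
      ((∏ i ∈ Finset.range n, (1 - z * q ^ i)) * (∏ i ∈ Finset.range n, (1 - q / z * q ^ i)) *
        (∏ i ∈ Finset.range (2 * n), (1 - q * q ^ i))⁻¹) := by
  induction n with
  | zero =>
    convert hasSum_single (0 : ℤ) _ using 1
    · simp [thetaTerm, invPoch]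
    · intro k hk
      rcases lt_or_gt_of_ne hk with h | h <;> simp [invPoch, h]
  | succ n ih =>
    have hl := (Equiv.addRight (1 : ℤ)).hasSum_iff.2 ih
    have hr := (Equiv.subRight (1 : ℤ)).hasSum_iff.2 ih
    have a1 := one_sub_mul_pow_ne_zero hq (2 * n)
    have a2 := one_sub_mul_pow_ne_zero hq (2 * n + 1)
    refine hasSum_of_eq (((((ih.mul_left (1 + q ^ (2 * n + 1))).sub (hr.mul_left (z * q ^ n))).sub
      (hl.mul_left (q ^ (n + 1) / z)))).mul_left
        (((1 - q * q ^ (2 * n)) * (1 - q * q ^ (2 * n + 1)))⁻¹)) (fun k ↦ ?_) ?_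
    · simp only [Function.comp_apply, Equiv.coe_addRight, Equiv.subRight_apply]
      rw [thetaTerm_add_one hq0 hz]
      have ht := thetaTerm_add_one hq0 hz (k - 1)
      rw [sub_add_cancel] at ht
      have g1 := invPoch_sub_one hq ((n + 1 : ℤ) - k)
      have g2 := invPoch_sub_one hq ((n + 1 : ℤ) + k)
      have g3 := invPoch_sub_one hq ((n + 1 : ℤ) - k - 1)
      have g4 := invPoch_sub_one hq ((n + 1 : ℤ) + k - 1)
      push_cast
      rw [show (n : ℤ) - (k - 1) = n + 1 - k by ring,
        show (n : ℤ) + (k - 1) = n + 1 + k - 1 - 1 by ring,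
        show (n : ℤ) - k = n + 1 - k - 1 by ring, show (n : ℤ) + k = n + 1 + k - 1 by ring,
        show (n : ℤ) - (k + 1) = n + 1 - k - 1 - 1 by ring,
        show (n : ℤ) + (k + 1) = n + 1 + k by ring, g3, g4, g1, g2, ht]
      rw [eq_inv_mul_iff_mul_eq₀ (mul_ne_zero a1 a2)]
      simp only [zpow_sub₀ hq0, zpow_add₀ hq0, zpow_natCast, zpow_one]
      have hk : q ^ k ≠ 0 := zpow_ne_zero _ hq0
      generalize invPoch q (n + 1 - k) = G1
      generalize invPoch q (n + 1 + k) = G2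
      generalize thetaTerm q z (k - 1) = t
      rw [show 2 * n = n + n by ring]
      simp only [pow_add, pow_one]
      generalize q ^ k = w at *
      generalize q ^ n = v at *
      field_simp
      ring
    · rw [show 2 * (n + 1) = 2 * n + 1 + 1 by ring]
      simp only [Finset.prod_range_succ, mul_inv]
      field_simp
      ring

lemma summable_norm_thetaTerm {q z : ℂ} (hq0 : q ≠ 0) (hq : ‖q‖ < 1) (hz : z ≠ 0) :
    Summable fun k : ℤ ↦ ‖thetaTerm q z k‖ := by
  have hne (k : ℤ) : ‖thetaTerm q z k‖ ≠ 0 := by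
    simp [thetaTerm, hq0, hz, zpow_ne_zero]
  have hlim := tendsto_pow_atTop_nhds_zero_of_lt_one (norm_nonneg q) hq
  refine Summable.of_nat_of_neg ?_ ?_
  · refine summable_of_ratio_test_tendsto_lt_one (l := 0) (by norm_num)
      (Eventually.of_forall fun n ↦ hne n) ?_
    have := hlim.const_mul ‖z‖
    rw [mul_zero] at this
    refine this.congr fun n ↦ ?_
    push_cast
    rw [thetaTerm_add_one hq0 hz, norm_norm, norm_norm, norm_mul, mul_div_assoc, div_self (hne _)]
    simp
  · refine summable_of_ratio_test_tendsto_lt_one (l := 0) (by norm_num)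
      (Eventually.of_forall fun n ↦ hne _) ?_
    have := hlim.const_mul (‖q‖ * ‖z‖⁻¹)
    rw [mul_zero] at this
    refine this.congr fun n ↦ ?_
    have h := thetaTerm_add_one hq0 hz (-((n + 1 : ℕ) : ℤ))
    rw [show -((n + 1 : ℕ) : ℤ) + 1 = -(n : ℤ) by push_cast; ring] at h
    rw [h, norm_norm, norm_norm, norm_mul, div_mul_cancel_right₀ (hne _), zpow_neg, zpow_natCast]
    simp [pow_succ]
    ring

/-- **Jacobi triple product identity.** -/
theorem hasSum_thetaTerm {q z : ℂ} (hq0 : q ≠ 0) (hq : ‖q‖ < 1) (hz : z ≠ 0) :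
    HasSum (thetaTerm q z) (thetaProd q z) := by
  have hs := summable_norm_thetaTerm hq0 hq hz
  obtain ⟨C, hC⟩ := exists_norm_invPoch_le hq
  have hC0 : 0 ≤ C := (norm_nonneg _).trans (hC 0)
  have hP := qPoch_self_ne_zero hq
  have h1 : Tendsto (fun n : ℕ ↦ ∑' k : ℤ,
      thetaTerm q z k * (invPoch q (n - k) * invPoch q (n + k))) atTop
      (𝓝 (∑' k : ℤ, thetaTerm q z k * ((qPoch q q)⁻¹ * (qPoch q q)⁻¹))) := by
    refine tendsto_tsum_of_dominated_convergence (hs.mul_right (C * C)) (fun k ↦ ?_)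
      (Eventually.of_forall fun n k ↦ ?_)
    · refine Tendsto.const_mul _ (((tendsto_invPoch hq).comp ?_).mul ((tendsto_invPoch hq).comp ?_))
      · exact tendsto_atTop_add_const_right _ (-k) tendsto_natCast_atTop_atTop
      · exact tendsto_atTop_add_const_right _ k tendsto_natCast_atTop_atTop
    · rw [norm_mul, norm_mul]
      gcongr <;> apply hC
  have h2 := ((tendsto_qPoch hq z).mul (tendsto_qPoch hq (q / z))).mul
    (((tendsto_qPoch hq q).comp
      (tendsto_id.const_mul_atTop' (show 0 < 2 by norm_num) : Tendsto (fun n : ℕ ↦ 2 * n) _ _)).inv₀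
        hP)
  have h3 := tendsto_nhds_unique (h1.congr fun n ↦ (hasSum_finite_triple hq0 hq hz n).tsum_eq) h2
  rw [tsum_mul_right] at h3
  refine hasSum_of_eq hs.of_norm.hasSum (fun _ ↦ rfl) ?_
  rw [thetaProd]
  field_simp at h3
  linear_combination -h3

lemma thetaProd_div {q z : ℂ} (hq0 : q ≠ 0) : thetaProd q (q / z) = thetaProd q z := by
  rw [thetaProd, thetaProd, div_div_cancel₀ hq0, mul_comm (qPoch q (q / z))]

lemma thetaProd_self {q : ℂ} (hq0 : q ≠ 0) (hq : ‖q‖ < 1) : thetaProd q q = 0 := by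
  rw [thetaProd, div_self hq0, qPoch_eq_mul hq 1]
  ring

lemma thetaTerm_five_mul_add {q z : ℂ} (hq0 : q ≠ 0) (hz : z ≠ 0) (m r : ℤ) :
    thetaTerm q z (5 * m + r) =
      thetaTerm q z r * thetaTerm (q ^ 25) (q ^ (10 + 5 * r) * z ^ 5) m := by
  have he : (5 * m + r) * (5 * m + r - 1) / 2 =
      25 * (m * (m - 1) / 2) + (10 + 5 * r) * m + r * (r - 1) / 2 := by
    obtain ⟨u, hu⟩ := (Int.even_mul_pred_self m).two_dvd
    obtain ⟨v, hv⟩ := (Int.even_mul_pred_self r).two_dvd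
    rw [hu, hv, show (5 * m + r) * (5 * m + r - 1) = 2 * (25 * u + (10 + 5 * r) * m + v) by
      linear_combination 25 * hu + hv]
    simp
  have h5 : (-1 : ℂ) ^ (5 * m) = (-1) ^ m := by
    rw [zpow_mul]
    norm_num
  rw [thetaTerm, thetaTerm, thetaTerm, he, zpow_add₀ hq0, zpow_add₀ hq0, zpow_add₀ hz,
    zpow_add₀ (by simp : (-1 : ℂ) ≠ 0), h5, mul_zpow, zpow_mul q 25, zpow_mul q (10 + 5 * r),
    zpow_mul z 5]
  norm_cast
  ring

/-- The `5`-dissection of the theta series at a primitive fifth root of unity. -/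
lemma thetaProd_root {q ζ : ℂ} (hq0 : q ≠ 0) (hq : ‖q‖ < 1)
    (hζ : 1 + ζ + ζ ^ 2 + ζ ^ 3 + ζ ^ 4 = 0) :
    thetaProd q ζ = (1 - ζ) * (thetaProd (q ^ 25) (q ^ 10) +
      q * thetaProd (q ^ 25) (q ^ 5) * (ζ ^ 2 + ζ ^ 3)) := by
  have hζ5 : ζ ^ 5 = 1 := by linear_combination (ζ - 1) * hζ
  have hζ0 : ζ ≠ 0 := by rintro rfl; simp at hζ
  have hQ0 : q ^ 25 ≠ 0 := pow_ne_zero _ hq0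
  have hQ : ‖q ^ 25‖ < 1 := by
    rw [norm_pow]; exact pow_lt_one₀ (norm_nonneg q) hq (by norm_num)
  have hsum := (((Int.divModEquiv 5).trans (Equiv.prodComm ℤ (Fin 5))).symm.trans
    (Equiv.subRight (1 : ℤ))).hasSum_iff.2 (hasSum_thetaTerm hq0 hq hζ0)
  have hfib (r : Fin 5) : HasSum (fun m : ℤ ↦ thetaTerm q ζ (5 * m + ((r : ℤ) - 1)))
      (thetaTerm q ζ ((r : ℤ) - 1) * thetaProd (q ^ 25) (q ^ (10 + 5 * ((r : ℤ) - 1)))) := by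
    refine hasSum_of_eq ((hasSum_thetaTerm hQ0 hQ (zpow_ne_zero _ hq0)).mul_left _)
      (fun m ↦ ?_) rfl
    rw [thetaTerm_five_mul_add hq0 hζ0, hζ5, mul_one]
  have hprod := hsum.prod_fiberwise (g := fun r : Fin 5 ↦ thetaTerm q ζ ((r : ℤ) - 1) *
    thetaProd (q ^ 25) (q ^ (10 + 5 * ((r : ℤ) - 1)))) fun r ↦ by
      refine hasSum_of_eq (hfib r) (fun m ↦ ?_) rfl
      simp only [Function.comp_apply, Equiv.trans_apply, Equiv.symm_trans_apply,
        Equiv.prodComm_symm, Equiv.prodComm_apply, Prod.swap_prod_mk, Int.divModEquiv_symm_apply,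
        Equiv.subRight_apply]
      congr 1
      push_cast
      ring
  rw [hprod.unique (hasSum_fintype _), Fin.sum_univ_five]
  have e1 : thetaProd (q ^ 25) (q ^ 15) = thetaProd (q ^ 25) (q ^ 10) := by
    rw [← thetaProd_div hQ0]; congr 1; field_simp
  have e2 : thetaProd (q ^ 25) (q ^ 20) = thetaProd (q ^ 25) (q ^ 5) := by
    rw [← thetaProd_div hQ0]; congr 1; field_simp
  have t0 : thetaTerm q ζ (-1) = -(q * ζ⁻¹) := by simp [thetaTerm]
  have t1 : thetaTerm q ζ 0 = 1 := by simp [thetaTerm]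
  have t2 : thetaTerm q ζ 1 = -ζ := by simp [thetaTerm]
  have t3 : thetaTerm q ζ 2 = q * ζ ^ 2 := by
    simp [thetaTerm]
  have hinv : ζ⁻¹ = ζ ^ 4 := by
    rw [inv_eq_iff_eq_inv, eq_comm, inv_eq_of_mul_eq_one_left]; linear_combination hζ5
  norm_num [t0, t1, t2, t3]
  norm_cast
  rw [e1, e2, thetaProd_self hQ0 hQ, hinv]
  ring

lemma qPoch_self_mul_qPoch_pow_five {q ζ : ℂ} (hq0 : q ≠ 0) (hq : ‖q‖ < 1)
    (hζ : 1 + ζ + ζ ^ 2 + ζ ^ 3 + ζ ^ 4 = 0) :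
    qPoch q q * qPoch (q ^ 5) (q ^ 5) =
      (thetaProd (q ^ 25) (q ^ 10) + q * thetaProd (q ^ 25) (q ^ 5) * (ζ ^ 2 + ζ ^ 3)) *
      (thetaProd (q ^ 25) (q ^ 10) + q * thetaProd (q ^ 25) (q ^ 5) * (ζ + ζ ^ 4)) := by
  have key {ζ : ℂ} (hζ : 1 + ζ + ζ ^ 2 + ζ ^ 3 + ζ ^ 4 = 0) :
      thetaProd (q ^ 25) (q ^ 10) + q * thetaProd (q ^ 25) (q ^ 5) * (ζ ^ 2 + ζ ^ 3) =
        qPoch q (ζ * q) * qPoch q (ζ ^ 4 * q) * qPoch q q := by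
    have hζ5 : ζ ^ 5 = 1 := by linear_combination (ζ - 1) * hζ
    have hζ0 : ζ ≠ 0 := by rintro rfl; simp at hζ
    have hζ1 : 1 - ζ ≠ 0 := fun h ↦ by
      rw [← sub_eq_zero.1 h] at hζ; norm_num at hζ
    have hd : q / ζ = ζ ^ 4 * q := by
      rw [div_eq_iff hζ0]; linear_combination -q * hζ5
    apply mul_left_cancel₀ hζ1
    rw [← thetaProd_root hq0 hq hζ, thetaProd, qPoch_eq_mul hq ζ, hd]
    ring
  have hζ5 : ζ ^ 5 = 1 := by linear_combination (ζ - 1) * hζ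
  have hζ' : 1 + ζ ^ 2 + (ζ ^ 2) ^ 2 + (ζ ^ 2) ^ 3 + (ζ ^ 2) ^ 4 = 0 := by
    linear_combination hζ + (ζ + ζ ^ 3) * hζ5
  have h2 := key hζ'
  rw [show (ζ ^ 2) ^ 2 + (ζ ^ 2) ^ 3 = ζ + ζ ^ 4 by linear_combination ζ * hζ5,
    show (ζ ^ 2) ^ 4 = ζ ^ 3 by linear_combination ζ ^ 3 * hζ5] at h2
  rw [key hζ, h2, ← qPoch_mul_roots hq hζ]
  ring

lemma prod_add_mul_roots {ζ : ℂ} (hζ : 1 + ζ + ζ ^ 2 + ζ ^ 3 + ζ ^ 4 = 0) (u v : ℂ) :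
    (u + v) * (u + ζ * v) * (u + ζ ^ 2 * v) * (u + ζ ^ 3 * v) * (u + ζ ^ 4 * v) =
      u ^ 5 + v ^ 5 := by
  grind

/-- The relation between `f(-q)`, `f(-q⁵)` and the two theta functions of level `5`. -/
theorem qPoch_self_pow_eleven {q : ℂ} (hq0 : q ≠ 0) (hq : ‖q‖ < 1) :
    qPoch q q ^ 11 = qPoch (q ^ 5) (q ^ 5) *
      (thetaProd (q ^ 5) (q ^ 2) ^ 10
        - 11 * q * thetaProd (q ^ 5) q ^ 5 * thetaProd (q ^ 5) (q ^ 2) ^ 5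
        - q ^ 2 * thetaProd (q ^ 5) q ^ 10) := by
  obtain ⟨x, rfl⟩ := IsAlgClosed.exists_pow_nat_eq q (show 0 < 5 by norm_num)
  have hx0 : x ≠ 0 := by rintro rfl; simp at hq0
  have hx : ‖x‖ < 1 := by
    rw [norm_pow] at hq
    exact lt_of_not_ge fun h ↦ hq.not_ge (one_le_pow₀ h)
  obtain ⟨ζ, hζp⟩ : ∃ ζ : ℂ, IsPrimitiveRoot ζ 5 := ⟨_, Complex.isPrimitiveRoot_exp 5 (by norm_num)⟩
  have hζ : 1 + ζ + ζ ^ 2 + ζ ^ 3 + ζ ^ 4 = 0 := by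
    simpa [Finset.sum_range_succ] using hζp.geom_sum_eq_zero (by norm_num)
  have hζn : ‖ζ‖ = 1 := Complex.norm_eq_one_of_pow_eq_one hζp.pow_eq_one (by norm_num)
  have hζ0 : ζ ≠ 0 := by rintro rfl; simp at hζ
  have hζ5 : ζ ^ 5 = 1 := hζp.pow_eq_one
  have key (k : ℕ) := qPoch_self_mul_qPoch_pow_five (q := ζ ^ k * x)
    (mul_ne_zero (pow_ne_zero _ hζ0) hx0) (by simpa [hζn] using hx) hζ
  have p5 (k : ℕ) : (ζ ^ k * x) ^ 5 = x ^ 5 := by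
    rw [mul_pow, ← pow_mul, mul_comm k, pow_mul, hζ5, one_pow, one_mul]
  have p10 (k : ℕ) : (ζ ^ k * x) ^ 10 = (x ^ 5) ^ 2 := by rw [← p5 k]; ring
  have p25 (k : ℕ) : (ζ ^ k * x) ^ 25 = (x ^ 5) ^ 5 := by rw [← p5 k]; ring
  simp only [p5, p10, p25] at key
  have hprod := qPoch_self_mul_roots hx hζ hζn
  have k0 := key 0
  have k1 := key 1
  simp only [pow_zero, one_mul, pow_one] at k0 k1
  have k2 := key 2
  have k3 := key 3
  have k4 := key 4
  generalize thetaProd ((x ^ 5) ^ 5) ((x ^ 5) ^ 2) = B at *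
  generalize thetaProd ((x ^ 5) ^ 5) (x ^ 5) = A at *
  generalize qPoch ((x ^ 5) ^ 5) ((x ^ 5) ^ 5) = G at *
  generalize qPoch (x ^ 5) (x ^ 5) = F at *
  obtain ⟨φ, hφ⟩ : ∃ φ, φ = ζ ^ 2 + ζ ^ 3 := ⟨_, rfl⟩
  obtain ⟨ψ, hψ⟩ : ∃ ψ, ψ = ζ + ζ ^ 4 := ⟨_, rfl⟩
  have h1 : ψ = -1 - φ := by linear_combination hφ + hψ + hζ
  have h2 : φ ^ 2 = 1 - φ := by
    rw [hφ]; linear_combination hζ + (ζ - 1) * hζ + (ζ + 1) * hζ5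
  rw [← hφ, ← hψ] at k0 k1 k2 k3 k4
  have P1 := prod_add_mul_roots hζ B (x * A * φ)
  have P2 := prod_add_mul_roots hζ B (x * A * ψ)
  have hφ5 : φ ^ 5 = 5 * φ - 3 := by
    linear_combination (φ ^ 3 - φ ^ 2 + 2 * φ - 3) * h2
  have hψ5 : ψ ^ 5 = -8 - 5 * φ := by
    have h3 : ψ ^ 2 = 1 - ψ := by rw [h1]; linear_combination h2
    linear_combination (ψ ^ 3 - ψ ^ 2 + 2 * ψ - 3) * h3 + 5 * h1
  calc F ^ 11 = F ^ 6 * F ^ 5 := by ring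
    _ = G * (((B + x * A * φ) * (B + ζ * (x * A * φ)) * (B + ζ ^ 2 * (x * A * φ)) *
          (B + ζ ^ 3 * (x * A * φ)) * (B + ζ ^ 4 * (x * A * φ))) *
        ((B + x * A * ψ) * (B + ζ * (x * A * ψ)) * (B + ζ ^ 2 * (x * A * ψ)) *
          (B + ζ ^ 3 * (x * A * ψ)) * (B + ζ ^ 4 * (x * A * ψ)))) := by
        rw [← hprod]
        trans G * ((qPoch x x * F) * (qPoch (ζ * x) (ζ * x) * F) *
          (qPoch (ζ ^ 2 * x) (ζ ^ 2 * x) * F) * (qPoch (ζ ^ 3 * x) (ζ ^ 3 * x) * F) *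
          (qPoch (ζ ^ 4 * x) (ζ ^ 4 * x) * F))
        · ring
        · rw [k0, k1, k2, k3, k4]
          ring
    _ = _ := by
        rw [P1, P2, mul_pow (x * A) φ, mul_pow (x * A) ψ, hφ5, hψ5]
        linear_combination -(25 * G * x ^ 10 * A ^ 10) * h2

lemma multipliable_one_sub_pow_zpow_chi5 {q : ℝ} (hq0 : 0 < q) (hq1 : q < 1) :
    Multipliable fun n : ℕ ↦ (1 - q ^ (n + 1)) ^ chi5 (n + 1) := by
  have hpos (n : ℕ) : 0 < 1 - q ^ (n + 1) :=
    sub_pos.2 (pow_lt_one₀ hq0.le hq1 (Nat.succ_ne_zero n))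
  refine Real.multipliable_of_summable_log (fun n ↦ zpow_pos (hpos n) _) ?_
  have h : Summable fun n : ℕ ↦ Real.log (1 + -q ^ (n + 1)) :=
    Real.summable_log_one_add_of_summable
      ((summable_nat_add_iff 1).2 (summable_geometric_of_lt_one hq0.le hq1)).neg
  refine Summable.of_norm_bounded h.norm fun n ↦ ?_
  have hchi : |(chi5 (n + 1) : ℝ)| ≤ 1 := by
    unfold chi5
    split_ifs <;> simp
  rw [Real.log_zpow, norm_mul, ← sub_eq_add_neg]
  exact mul_le_of_le_one_left (norm_nonneg _) hchi

lemma ofReal_tprod_chi5 {q : ℝ} (hq0 : 0 < q) (hq1 : q < 1) :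
    ((∏' n : ℕ, (1 - q ^ (n + 1)) ^ chi5 (n + 1) : ℝ) : ℂ) *
      (qPoch (q ^ 5) (q ^ 2) * qPoch (q ^ 5) (q ^ 3)) =
      qPoch (q ^ 5) q * qPoch (q ^ 5) (q ^ 4) := by
  have hq5 : ‖(q : ℂ) ^ 5‖ < 1 := by
    rw [norm_pow, Complex.norm_real, Real.norm_of_nonneg hq0.le]
    exact pow_lt_one₀ hq0.le hq1 (by norm_num)
  have h1 := ((Complex.continuous_ofReal.tendsto _).comp
    (multipliable_one_sub_pow_zpow_chi5 hq0 hq1).tendsto_prod_tprod_nat).comp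
    (tendsto_id.const_mul_atTop' (show 0 < 5 by norm_num) : Tendsto (fun n : ℕ ↦ 5 * n) _ _)
  refine tendsto_nhds_unique (h1.mul ((tendsto_qPoch hq5 _).mul (tendsto_qPoch hq5 _)))
    (((tendsto_qPoch hq5 _).mul (tendsto_qPoch hq5 _)).congr fun N ↦ ?_)
  simp only [Function.comp_apply]
  induction N with
  | zero => simp
  | succ N ih =>
    have hne (n : ℕ) : (1 - (q : ℂ) ^ (n + 1)) ≠ 0 := by
      have : 0 < 1 - q ^ (n + 1) := sub_pos.2 (pow_lt_one₀ hq0.le hq1 (Nat.succ_ne_zero n))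
      exact_mod_cast this.ne'
    have c1 : chi5 (5 * N + 1) = 1 := by simp [chi5]
    have c2 : chi5 (5 * N + 1 + 1) = -1 := by simp [chi5]; omega
    have c3 : chi5 (5 * N + 2 + 1) = -1 := by simp [chi5]; omega
    have c4 : chi5 (5 * N + 3 + 1) = 1 := by simp [chi5]; omega
    have c5 : chi5 (5 * N + 4 + 1) = 0 := by simp [chi5]; omega
    have n2 := hne (5 * N + 1)
    have n3 := hne (5 * N + 2)
    rw [Finset.prod_range_succ, Finset.prod_range_succ _ N, Finset.prod_range_succ _ N,
      Finset.prod_range_succ _ N, Nat.mul_succ]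
    simp only [Finset.prod_range_succ _ (5 * N + _), Finset.prod_range_succ _ (5 * N), c1, c2, c3,
      c4, c5, zpow_one, zpow_neg, zpow_zero, Complex.ofReal_mul, Complex.ofReal_inv,
      Complex.ofReal_sub, Complex.ofReal_pow, Complex.ofReal_one]
    rw [mul_mul_mul_comm, ih]
    rw [show (q : ℂ) ^ 2 * (q ^ 5) ^ N = q ^ (5 * N + 1 + 1) by ring,
      show (q : ℂ) ^ 3 * (q ^ 5) ^ N = q ^ (5 * N + 2 + 1) by ring]
    field_simp
    ring

lemma ofReal_ramanujanF {q : ℝ} (hq0 : 0 < q) (hq1 : q < 1) :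
    (ramanujanF q : ℂ) = qPoch q q := by
  have hs : Summable fun n : ℕ ↦ -q ^ (n + 1) :=
    ((summable_nat_add_iff 1).2 (summable_geometric_of_lt_one hq0.le hq1)).neg
  have hm : Multipliable fun n : ℕ ↦ 1 - q ^ (n + 1) := by
    simpa only [sub_eq_add_neg] using Real.multipliable_one_add_of_summable hs
  have h := hm.map_tprod Complex.ofRealHom Complex.continuous_ofReal
  simpa [ramanujanF, qPoch, pow_succ'] using h

theorem rogersRamanujan_fifth_power_relation
    (q : ℝ) (hq0 : 0 < q) (hq1 : q < 1) :
    1 / RR q ^ 5 - 11 - RR q ^ 5 = ramanujanF q ^ 6 / (q * ramanujanF (q ^ 5) ^ 6) := by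
  have hc0 : (q : ℂ) ≠ 0 := by exact_mod_cast hq0.ne'
  have hc : ‖(q : ℂ)‖ < 1 := by rwa [Complex.norm_real, Real.norm_of_nonneg hq0.le]
  have hRR : RR q ^ 5 = q * (∏' n : ℕ, (1 - q ^ (n + 1)) ^ chi5 (n + 1)) ^ 5 := by
    rw [RR, mul_pow, ← Real.rpow_natCast, ← Real.rpow_mul hq0.le]
    norm_num
  have hP := ofReal_tprod_chi5 hq0 hq1
  have hF := ofReal_ramanujanF hq0 hq1
  have hG := ofReal_ramanujanF (pow_pos hq0 5) (pow_lt_one₀ hq0.le hq1 (by norm_num))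
  have main := qPoch_self_pow_eleven hc0 hc
  have hF0 := qPoch_self_ne_zero hc
  have hd := qPoch_dissect hc q
  have e1 : (q : ℂ) ^ 5 / q = q ^ 4 := by field_simp
  have e2 : (q : ℂ) ^ 5 / q ^ 2 = q ^ 3 := by field_simp
  simp only [Finset.prod_range_succ, Finset.prod_range_zero, one_mul, ← pow_succ',
    zero_add, pow_one, Nat.reduceAdd] at hd
  rw [← Complex.ofReal_inj, hRR]
  push_cast at hG ⊢
  rw [hF, hG]
  simp only [thetaProd, e1, e2] at main
  rw [hd] at main hF0 ⊢
  simp only [mul_ne_zero_iff] at hF0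
  obtain ⟨⟨⟨⟨n1, n2⟩, n3⟩, n4⟩, n5⟩ := hF0
  rw [← eq_div_iff (mul_ne_zero n2 n3)] at hP
  rw [hP]
  generalize qPoch ((q : ℂ) ^ 5) q = a1 at *
  generalize qPoch ((q : ℂ) ^ 5) (q ^ 2) = a2 at *
  generalize qPoch ((q : ℂ) ^ 5) (q ^ 3) = a3 at *
  generalize qPoch ((q : ℂ) ^ 5) (q ^ 4) = a4 at *
  generalize qPoch ((q : ℂ) ^ 5) (q ^ 5) = a5 at *
  have main' : (a1 * a4) ^ 11 * (a2 * a3) ^ 11 =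
      (a2 * a3) ^ 10 - 11 * q * (a1 * a4) ^ 5 * (a2 * a3) ^ 5 - q ^ 2 * (a1 * a4) ^ 10 := by
    apply mul_left_cancel₀ (pow_ne_zero 11 n5)
    linear_combination main
  field_simp
  linear_combination -main'
end

section
/- Define H(x) = e^{−x/2} ∏_{n=1}^∞ [(1 − e^{−(8n−7)x})(1 − e^{−(8n−1)x})] / [(1 − e^{−(8n−5)x})(1 − e^{−(8n−3)x})] for real x > 0. If a, b > 0 and a·b = π², then (1 + √2 + H(a)) · (1 + √2 + H(b)) = 2(2 + √2). -/
open Real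

/-- The Ramanujan–Göllnitz–Gordon continued fraction, given by its product
representation `H(x) = e^{-x/2} (q;q⁸)_∞ (q⁷;q⁸)_∞ / ((q³;q⁸)_∞ (q⁵;q⁸)_∞)`
with `q = e^{-x}`. -/
noncomputable def H (x : ℝ) : ℝ :=
  Real.exp (-x / 2) *
    ∏' n : ℕ,
      (1 - Real.exp (-((8 * n + 1) * x))) * (1 - Real.exp (-((8 * n + 7) * x))) /
        ((1 - Real.exp (-((8 * n + 3) * x))) * (1 - Real.exp (-((8 * n + 5) * x))))

section

open Filter Topology

/-- The reciprocal `1 / (P; P)_k` of the q-Pochhammer symbol, extended by zero to negative `k`. -/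
noncomputable def invQPochhammer (P : ℝ) (k : ℤ) : ℝ :=
  if k < 0 then 0 else (∏ i ∈ Finset.range k.toNat, (1 - P ^ (i + 1)))⁻¹

theorem one_sub_pow_succ_pos {P : ℝ} (hP0 : 0 < P) (hP1 : P < 1) (i : ℕ) :
    0 < 1 - P ^ (i + 1) :=
  sub_pos.2 (pow_lt_one₀ hP0.le hP1 i.succ_ne_zero)

theorem invQPochhammer_natCast (P : ℝ) (k : ℕ) :
    invQPochhammer P k = (∏ i ∈ Finset.range k, (1 - P ^ (i + 1)))⁻¹ := by
  simp [invQPochhammer]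

theorem invQPochhammer_of_neg (P : ℝ) {k : ℤ} (hk : k < 0) : invQPochhammer P k = 0 := by
  simp [invQPochhammer, hk]

theorem invQPochhammer_sub_one {P : ℝ} (hP0 : 0 < P) (hP1 : P < 1) (k : ℤ) :
    invQPochhammer P (k - 1) = invQPochhammer P k * (1 - P ^ k) := by
  rcases lt_trichotomy k 0 with hk | rfl | hk
  · rw [invQPochhammer_of_neg P hk, invQPochhammer_of_neg P (by lia), zero_mul]
  · rw [invQPochhammer_of_neg P (by lia)]; simp
  · obtain ⟨m, rfl⟩ : ∃ m : ℕ, k = (m + 1 : ℕ) := ⟨k.toNat - 1, by lia⟩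
    have h1 : ((m + 1 : ℕ) : ℤ) - 1 = (m : ℕ) := by push_cast; ring
    rw [h1, invQPochhammer_natCast, invQPochhammer_natCast, Finset.prod_range_succ, zpow_natCast]
    have := (one_sub_pow_succ_pos hP0 hP1 m).ne'
    rw [mul_inv, mul_assoc, inv_mul_cancel₀ this, mul_one]

theorem invQPochhammer_nonneg {P : ℝ} (hP0 : 0 < P) (hP1 : P < 1) (k : ℤ) :
    0 ≤ invQPochhammer P k := by
  unfold invQPochhammer
  split_ifs
  · exact le_rfl
  · exact inv_nonneg.2 (Finset.prod_nonneg fun i _ => (one_sub_pow_succ_pos hP0 hP1 i).le)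

theorem exists_tendsto_invQPochhammer {P : ℝ} (hP0 : 0 < P) (hP1 : P < 1) :
    ∃ L, L ≠ 0 ∧ Tendsto (invQPochhammer P) atTop (𝓝 L) := by
  have hs : Summable fun i : ℕ => ‖-P ^ (i + 1)‖ := by
    simpa [abs_of_pos hP0] using
      (summable_nat_add_iff (f := fun i : ℕ => P ^ i) 1).2 (summable_geometric_of_lt_one hP0.le hP1)
  have hne : ∏' i : ℕ, (1 + -P ^ (i + 1)) ≠ 0 :=
    tprod_one_add_ne_zero_of_summable
      (fun i => by simpa [sub_eq_add_neg] using (one_sub_pow_succ_pos hP0 hP1 i).ne') hs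
  have ht := (multipliable_one_add_of_summable hs).tendsto_prod_tprod_nat.inv₀ hne
  refine ⟨_, inv_ne_zero hne, ?_⟩
  have hN : Tendsto Int.toNat atTop atTop :=
    tendsto_atTop.2 fun b => (eventually_ge_atTop (b : ℤ)).mono fun k hk => by lia
  refine (ht.comp hN).congr' ((eventually_ge_atTop (0 : ℤ)).mono fun k hk => ?_)
  simp [invQPochhammer, not_lt.2 hk, sub_eq_add_neg]

theorem exists_invQPochhammer_le {P : ℝ} (hP0 : 0 < P) (hP1 : P < 1) :
    ∃ C, ∀ k, invQPochhammer P k ≤ C := by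
  obtain ⟨L, -, hL⟩ := exists_tendsto_invQPochhammer hP0 hP1
  obtain ⟨C, hC⟩ := (hL.comp tendsto_natCast_atTop_atTop).bddAbove_range
  have hC' : ∀ n : ℕ, invQPochhammer P n ≤ C := fun n => hC ⟨n, rfl⟩
  refine ⟨C, fun k => ?_⟩
  rcases lt_or_ge k 0 with hk | hk
  · rw [invQPochhammer_of_neg P hk]
    exact (invQPochhammer_nonneg hP0 hP1 _).trans (hC' 0)
  · lift k to ℕ using hk
    exact hC' k

/-- The coefficients in the finite form of the Jacobi triple product. -/
noncomputable def tripleCoeff (p : ℝ) (N : ℕ) (n : ℤ) : ℝ :=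
  p ^ (n ^ 2) * (invQPochhammer (p ^ 2) (N - n) * invQPochhammer (p ^ 2) (N + n))

theorem tripleCoeff_succ {p : ℝ} (hp0 : 0 < p) (hp1 : p < 1) (N : ℕ) (n : ℤ) :
    tripleCoeff p (N + 1) n * ((1 - (p ^ 2) ^ (2 * N + 1)) * (1 - (p ^ 2) ^ (2 * N + 2))) =
      tripleCoeff p N n * (1 + (p ^ (2 * N + 1)) ^ 2) +
        p ^ (2 * N + 1) * (tripleCoeff p N (n - 1) + tripleCoeff p N (n + 1)) := by
  have hP0 : 0 < p ^ 2 := by positivity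
  have hP1 : p ^ 2 < 1 := pow_lt_one₀ hp0.le hp1 two_ne_zero
  have hP := hP0.ne'
  have hp := hp0.ne'
  have e1 := invQPochhammer_sub_one hP0 hP1 (N + 1 - n)
  have e2 := invQPochhammer_sub_one hP0 hP1 (N - n)
  have e3 := invQPochhammer_sub_one hP0 hP1 (N + 1 + n)
  have e4 := invQPochhammer_sub_one hP0 hP1 (N + n)
  rw [show (N : ℤ) + 1 - n - 1 = N - n by ring] at e1
  rw [show (N : ℤ) + 1 + n - 1 = N + n by ring] at e3
  simp only [tripleCoeff]
  push_cast
  rw [show (N : ℤ) - (n - 1) = N + 1 - n by ring, show (N : ℤ) + (n - 1) = N + n - 1 by ring,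
    show (N : ℤ) - (n + 1) = N - n - 1 by ring, show (N : ℤ) + (n + 1) = N + 1 + n by ring,
    e2, e4, e1, e3]
  have hA : p ^ (2 * N + 1) * p ^ ((n - 1) ^ 2) = (p ^ 2) ^ ((N : ℤ) + 1 - n) * p ^ (n ^ 2) := by
    rw [← zpow_natCast, ← zpow_natCast p 2, ← zpow_mul, ← zpow_add₀ hp, ← zpow_add₀ hp]
    congr 1; push_cast; ring
  have hB : p ^ (2 * N + 1) * p ^ ((n + 1) ^ 2) = (p ^ 2) ^ ((N : ℤ) + 1 + n) * p ^ (n ^ 2) := by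
    rw [← zpow_natCast, ← zpow_natCast p 2, ← zpow_mul, ← zpow_add₀ hp, ← zpow_add₀ hp]
    congr 1; push_cast; ring
  have hA' : (p ^ 2) ^ ((N : ℤ) + 1 - n) = (p ^ 2) ^ ((N : ℤ) - n) * p ^ 2 := by
    rw [← zpow_add_one₀ hP]; congr 1; ring
  have hB' : (p ^ 2) ^ ((N : ℤ) + 1 + n) = (p ^ 2) ^ ((N : ℤ) + n) * p ^ 2 := by
    rw [← zpow_add_one₀ hP]; congr 1; ring
  have hAB : (p ^ 2) ^ (2 * N) = (p ^ 2) ^ ((N : ℤ) - n) * (p ^ 2) ^ ((N : ℤ) + n) := by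
    rw [← zpow_add₀ hP, ← zpow_natCast]; congr 1; push_cast; ring
  have ht : (p ^ (2 * N + 1)) ^ 2 = (p ^ 2) ^ (2 * N) * p ^ 2 := by ring
  rw [ht, pow_succ (p ^ 2) (2 * N), pow_add (p ^ 2) (2 * N) 2, hAB]
  rw [hA'] at hA
  rw [hB'] at hB
  rw [hA', hB']
  clear hA' hB' hAB ht e1 e2 e3 e4
  generalize (p ^ 2) ^ ((N : ℤ) - n) = X at *
  generalize (p ^ 2) ^ ((N : ℤ) + n) = Y at *
  generalize invQPochhammer (p ^ 2) ((N : ℤ) + 1 - n) = a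
  generalize invQPochhammer (p ^ 2) ((N : ℤ) + 1 + n) = b
  generalize p ^ (n ^ 2) = G at *
  generalize p ^ ((n - 1) ^ 2) = G₁ at *
  generalize p ^ ((n + 1) ^ 2) = G₂ at *
  linear_combination (-(a * b * (1 - Y * p ^ 2) * (1 - Y))) * hA -
    (a * b * (1 - X * p ^ 2) * (1 - X)) * hB

/-- The finite form of the Jacobi triple product. -/
theorem hasSum_tripleCoeff {p z : ℝ} (hp0 : 0 < p) (hp1 : p < 1) (hz : z ≠ 0) (N : ℕ) :
    HasSum (fun n : ℤ => tripleCoeff p N n * z ^ n)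
      ((∏ k ∈ Finset.range N, (1 + z * p ^ (2 * k + 1)) * (1 + z⁻¹ * p ^ (2 * k + 1))) *
        invQPochhammer (p ^ 2) (2 * N : ℕ)) := by
  have hP0 : 0 < p ^ 2 := by positivity
  have hP1 : p ^ 2 < 1 := pow_lt_one₀ hp0.le hp1 two_ne_zero
  induction N with
  | zero =>
    have h0 : HasSum (fun n : ℤ => tripleCoeff p 0 n * z ^ n)
        (tripleCoeff p 0 0 * z ^ (0 : ℤ)) := by
      refine hasSum_single (0 : ℤ) fun n hn => ?_
      rcases lt_or_gt_of_ne hn with h | h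
      · simp [tripleCoeff, invQPochhammer_of_neg (p ^ 2) h]
      · simp [tripleCoeff, invQPochhammer_of_neg (p ^ 2) (neg_lt_zero.2 h)]
    simpa [tripleCoeff, invQPochhammer] using h0
  | succ N ih =>
    set S := (∏ k ∈ Finset.range N, (1 + z * p ^ (2 * k + 1)) * (1 + z⁻¹ * p ^ (2 * k + 1))) *
      invQPochhammer (p ^ 2) (2 * N : ℕ) with hS
    set D := (1 - (p ^ 2) ^ (2 * N + 1)) * (1 - (p ^ 2) ^ (2 * N + 2)) with hD
    have hD0 : D ≠ 0 := mul_ne_zero (one_sub_pow_succ_pos hP0 hP1 _).ne'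
      (one_sub_pow_succ_pos hP0 hP1 _).ne'
    have h1 := (Equiv.subRight (1 : ℤ)).hasSum_iff.2 ih
    have h2 := (Equiv.addRight (1 : ℤ)).hasSum_iff.2 ih
    have h := ((ih.mul_right (1 + (p ^ (2 * N + 1)) ^ 2)).add
      ((h1.mul_left (p ^ (2 * N + 1) * z)).add (h2.mul_left (p ^ (2 * N + 1) * z⁻¹)))).div_const D
    convert! h using 1
    · ext n
      rw [eq_div_iff hD0]
      simp only [Function.comp_apply, Equiv.subRight_apply, Equiv.coe_addRight]
      rw [mul_right_comm, tripleCoeff_succ hp0 hp1, zpow_sub_one₀ hz, zpow_add_one₀ hz]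
      field_simp
    · have hr : invQPochhammer (p ^ 2) (2 * (N + 1) : ℕ) * D =
          invQPochhammer (p ^ 2) (2 * N : ℕ) := by
        have e1 := invQPochhammer_sub_one hP0 hP1 (2 * N + 2 : ℕ)
        have e2 := invQPochhammer_sub_one hP0 hP1 (2 * N + 1 : ℕ)
        rw [show ((2 * N + 2 : ℕ) : ℤ) - 1 = (2 * N + 1 : ℕ) by push_cast; ring,
          zpow_natCast] at e1
        rw [show ((2 * N + 1 : ℕ) : ℤ) - 1 = (2 * N : ℕ) by push_cast; ring, e1,
          zpow_natCast] at e2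
        rw [e2, hD, mul_add_one]
        ring
      rw [eq_div_iff hD0, Finset.prod_range_succ, mul_assoc, hr, hS]
      field_simp
      ring

/-- The Jacobi triple product, up to a factor that does not depend on `z`. -/
theorem exists_tendsto_tripleProduct {p : ℝ} (hp0 : 0 < p) (hp1 : p < 1) :
    ∃ L ≠ 0, ∀ z ≠ 0, Summable (fun n : ℤ => p ^ (n ^ 2) * |z| ^ n) →
      Tendsto (fun N => ∏ k ∈ Finset.range N,
        (1 + z * p ^ (2 * k + 1)) * (1 + z⁻¹ * p ^ (2 * k + 1))) atTop
        (𝓝 (L * ∑' n : ℤ, p ^ (n ^ 2) * z ^ n)) := by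
  have hP0 : 0 < p ^ 2 := by positivity
  have hP1 : p ^ 2 < 1 := pow_lt_one₀ hp0.le hp1 two_ne_zero
  obtain ⟨L, hL0, hL⟩ := exists_tendsto_invQPochhammer hP0 hP1
  obtain ⟨C, hC⟩ := exists_invQPochhammer_le hP0 hP1
  refine ⟨L, hL0, fun z hz hsum => ?_⟩
  have hnn := invQPochhammer_nonneg hP0 hP1
  have hC0 : 0 ≤ C := (hnn 0).trans (hC 0)
  have key : Tendsto (fun N : ℕ => ∑' n : ℤ, tripleCoeff p N n * z ^ n) atTop
      (𝓝 (∑' n : ℤ, p ^ (n ^ 2) * (L * L) * z ^ n)) := by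
    refine tendsto_tsum_of_dominated_convergence (hsum.mul_left (C * C)) (fun n => ?_)
      (Eventually.of_forall fun N n => ?_)
    · refine Tendsto.mul_const _ (Tendsto.const_mul _ (Tendsto.mul ?_ ?_))
      · exact hL.comp (tendsto_atTop_add_const_right _ (-n) tendsto_natCast_atTop_atTop)
      · exact hL.comp (tendsto_atTop_add_const_right _ n tendsto_natCast_atTop_atTop)
    · have h0 : 0 < p ^ (n ^ 2) := by positivity
      rw [tripleCoeff, norm_mul, norm_mul, norm_mul, Real.norm_of_nonneg (hnn _),
        Real.norm_of_nonneg (hnn _), Real.norm_of_nonneg h0.le, Real.norm_eq_abs, abs_zpow]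
      calc _ ≤ p ^ (n ^ 2) * (C * C) * |z| ^ n := by
            gcongr
            · exact hnn _
            · exact hC _
            · exact hC _
        _ = _ := by ring
  have hr : Tendsto (fun N : ℕ => invQPochhammer (p ^ 2) (2 * N : ℕ)) atTop (𝓝 L) :=
    hL.comp (tendsto_natCast_atTop_atTop.comp (tendsto_id.const_mul_atTop' two_pos))
  have h := key.div hr hL0
  have hlim : (∑' n : ℤ, p ^ (n ^ 2) * (L * L) * z ^ n) / L = L * ∑' n : ℤ, p ^ (n ^ 2) * z ^ n := by
    rw [show (fun n : ℤ => p ^ (n ^ 2) * (L * L) * z ^ n) =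
      fun n : ℤ => L * L * (p ^ (n ^ 2) * z ^ n) by ext; ring, tsum_mul_left]
    field_simp
  rw [hlim] at h
  refine h.congr fun N => ?_
  have hne : invQPochhammer (p ^ 2) (2 * N : ℕ) ≠ 0 := by
    rw [invQPochhammer_natCast]
    exact inv_ne_zero (Finset.prod_ne_zero_iff.2 fun i _ => (one_sub_pow_succ_pos hP0 hP1 i).ne')
  rw [Pi.div_apply, (hasSum_tripleCoeff hp0 hp1 hz N).tsum_eq, mul_div_cancel_right₀ _ hne]

theorem exp_intCast_mul (n : ℤ) (y : ℝ) : Real.exp (n * y) = Real.exp y ^ n := by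
  rw [mul_comm, Real.exp_mul, Real.rpow_intCast]

/-- The theta function `∑ (-1)ⁿ q^((8n+w)²/16)` with `q = e^{-x}`. -/
noncomputable def altTheta (x w : ℝ) : ℝ :=
  ∑' n : ℤ, (-1) ^ n * Real.exp (-(x * (8 * n + w) ^ 2 / 16))

/-- The theta function `∑ e^{-x(n+w)²}`. -/
noncomputable def shiftedTheta (x w : ℝ) : ℝ := ∑' n : ℤ, Real.exp (-(x * (n + w) ^ 2))

theorem summable_exp_neg_sq {a : ℝ} (ha : 0 < a) (b : ℝ) :
    Summable fun n : ℤ => Real.exp (-(a * (n + b) ^ 2)) := by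
  have h := (summable_pow_mul_jacobiTheta₂_term_bound (a * |b| / π) (div_pos ha pi_pos) 0)
  refine h.of_nonneg_of_le (fun n => (Real.exp_pos _).le) fun n => ?_
  rw [pow_zero, one_mul, Real.exp_le_exp]
  have h1 : -π * (a / π * (n : ℝ) ^ 2 - 2 * (a * |b| / π) * (|n| : ℤ)) =
      -(a * n ^ 2) + 2 * a * (|b| * |(n : ℝ)|) := by
    push_cast
    field_simp
    ring
  rw [h1]
  have h2 : -(n * b) ≤ |b| * |(n : ℝ)| := by
    rw [← abs_mul, mul_comm b]
    exact neg_le_abs _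
  nlinarith [mul_le_mul_of_nonneg_left h2 ha.le, mul_nonneg ha.le (sq_nonneg b)]

theorem summable_norm_altTheta {x : ℝ} (hx : 0 < x) {m d w : ℝ} (hm : m ≠ 0) (hd : 0 < d) :
    Summable fun n : ℤ => ‖(-1) ^ n * Real.exp (-(x * (m * n + w) ^ 2 / d))‖ := by
  refine (summable_exp_neg_sq (a := x * m ^ 2 / d) (by positivity) (w / m)).congr fun n => ?_
  rw [norm_mul, norm_zpow, norm_neg, norm_one, one_zpow, one_mul,
    Real.norm_of_nonneg (Real.exp_pos _).le]
  congr 1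
  field_simp

theorem exists_tendsto_prod_altTheta {x : ℝ} (hx : 0 < x) :
    ∃ L ≠ 0, ∀ w : ℝ, Tendsto (fun N => ∏ k ∈ Finset.range N,
      (1 - Real.exp (-((8 * k + (4 + w)) * x))) * (1 - Real.exp (-((8 * k + (4 - w)) * x)))) atTop
      (𝓝 (L * (Real.exp (w ^ 2 * x / 16) * altTheta x w))) := by
  obtain ⟨L, hL0, hL⟩ := exists_tendsto_tripleProduct (Real.exp_pos (-(4 * x)))
    (Real.exp_lt_one_iff.2 (by linarith))
  refine ⟨L, hL0, fun w => ?_⟩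
  have hexp : ∀ n : ℤ, Real.exp (-(4 * x)) ^ (n ^ 2) * Real.exp (-(w * x)) ^ n =
      Real.exp (w ^ 2 * x / 16) * Real.exp (-(x * (8 * n + w) ^ 2 / 16)) := fun n => by
    rw [← exp_intCast_mul, ← exp_intCast_mul, ← Real.exp_add, ← Real.exp_add]
    congr 1
    push_cast
    ring
  have h := hL (-Real.exp (-(w * x))) (neg_ne_zero.2 (Real.exp_ne_zero _)) ?_
  · convert! h using 2
    · refine Finset.prod_congr rfl fun k _ => ?_
      rw [inv_neg, ← Real.exp_neg, ← Real.exp_nat_mul, neg_mul, neg_mul, ← Real.exp_add,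
        ← Real.exp_add, ← sub_eq_add_neg, ← sub_eq_add_neg]
      congr 3 <;> · push_cast; ring_nf
    · rw [altTheta, ← tsum_mul_left]
      congr 2
      ext n
      rw [neg_eq_neg_one_mul (Real.exp (-(w * x))), mul_zpow, mul_left_comm,
        mul_left_comm (_ ^ (n ^ 2)), hexp]
  · rw [abs_neg, abs_of_pos (Real.exp_pos _)]
    simp_rw [hexp]
    refine Summable.mul_left _ ?_
    have := summable_norm_altTheta hx (m := 8) (d := 16) (w := w) (by norm_num) (by norm_num)
    refine this.congr fun n => ?_
    rw [norm_mul, norm_zpow, norm_neg, norm_one, one_zpow, one_mul,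
      Real.norm_of_nonneg (Real.exp_pos _).le]

theorem multipliable_one_sub_exp {x c : ℝ} (hx : 0 < x) (hc : 0 < c) :
    Multipliable (fun n : ℕ => 1 - Real.exp (-((8 * n + c) * x))) ∧
      ∏' n : ℕ, (1 - Real.exp (-((8 * n + c) * x))) ≠ 0 := by
  have hs : Summable fun n : ℕ => ‖-Real.exp (-((8 * n + c) * x))‖ := by
    have hg := (summable_geometric_of_lt_one (Real.exp_pos (-(8 * x))).le
      (Real.exp_lt_one_iff.2 (by linarith))).mul_left (Real.exp (-(c * x)))
    refine hg.congr fun n => ?_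
    rw [norm_neg, Real.norm_of_nonneg (Real.exp_pos _).le, ← Real.exp_nat_mul, ← Real.exp_add]
    congr 1
    ring
  simp_rw [sub_eq_add_neg]
  refine ⟨multipliable_one_add_of_summable hs, tprod_one_add_ne_zero_of_summable (fun n => ?_) hs⟩
  rw [← sub_eq_add_neg]
  exact (sub_pos.2 (Real.exp_lt_one_iff.2 (neg_lt_zero.2 (by positivity)))).ne'

theorem H_eq_altTheta_div {x : ℝ} (hx : 0 < x) :
    altTheta x 1 ≠ 0 ∧ H x = altTheta x 3 / altTheta x 1 := by
  obtain ⟨L, hL0, hL⟩ := exists_tendsto_prod_altTheta hx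
  obtain ⟨m1, n1⟩ := multipliable_one_sub_exp hx (c := 1) (by norm_num)
  obtain ⟨m3, n3⟩ := multipliable_one_sub_exp hx (c := 3) (by norm_num)
  obtain ⟨m5, n5⟩ := multipliable_one_sub_exp hx (c := 5) (by norm_num)
  obtain ⟨m7, n7⟩ := multipliable_one_sub_exp hx (c := 7) (by norm_num)
  have hnum := tendsto_nhds_unique (m1.mul m7).tendsto_prod_tprod_nat <| (hL 3).congr fun N => by
    refine Finset.prod_congr rfl fun k _ => ?_
    norm_num [mul_comm]
  have hden := tendsto_nhds_unique (m3.mul m5).tendsto_prod_tprod_nat <| (hL 1).congr fun N => by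
    refine Finset.prod_congr rfl fun k _ => ?_
    norm_num [mul_comm]
  have hne := mul_ne_zero n3 n5
  rw [← m3.tprod_mul m5] at hne
  have h1 : altTheta x 1 ≠ 0 := by
    rintro h
    rw [hden, h] at hne
    simp at hne
  refine ⟨h1, ?_⟩
  rw [H, (m1.mul m7).tprod_div₀ (m3.mul m5) hne, hnum, hden, mul_div_mul_left _ _ hL0]
  have he : Real.exp (-x / 2) * Real.exp (3 ^ 2 * x / 16) = Real.exp (1 ^ 2 * x / 16) := by
    rw [← Real.exp_add]
    congr 1
    ring
  have := Real.exp_ne_zero (1 ^ 2 * x / 16)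
  rw [mul_div_assoc', ← mul_assoc, he, mul_div_mul_left _ _ this]

theorem H_nonneg {x : ℝ} (hx : 0 < x) : 0 ≤ H x := by
  have h : ∀ (n : ℕ) (c : ℝ), 0 < c → 0 ≤ 1 - Real.exp (-((8 * n + c) * x)) := fun n c hc =>
    (sub_pos.2 (Real.exp_lt_one_iff.2 (neg_lt_zero.2 (by positivity)))).le
  unfold H
  refine mul_nonneg (Real.exp_pos _).le (tprod_nonneg fun n => ?_)
  exact div_nonneg (mul_nonneg (h n 1 (by norm_num)) (h n 7 (by norm_num)))
    (mul_nonneg (h n 3 (by norm_num)) (h n 5 (by norm_num)))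

theorem tsum_eq_add_of_bijective_sumElim {α β γ : Type*} {i : α → γ} {j : β → γ}
    (hij : Function.Bijective (Sum.elim i j)) {F : γ → ℝ} (hF : Summable F) :
    ∑' c, F c = ∑' a, F (i a) + ∑' b, F (j b) := by
  rw [← (Equiv.ofBijective _ hij).tsum_eq F]
  have hs := (Equiv.ofBijective _ hij).summable_iff.2 hF
  exact Summable.tsum_sum (f := fun c => F (Sum.elim i j c))
    (hs.comp_injective Sum.inl_injective) (hs.comp_injective Sum.inr_injective)

theorem bijective_even_odd :
    Function.Bijective (Sum.elim (fun n : ℤ => 2 * n) (fun n : ℤ => 2 * n + 1)) := by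
  constructor
  · rintro (a | a) (b | b) h <;> simp only [Sum.elim_inl, Sum.elim_inr] at h
    · congr 1; lia
    · lia
    · lia
    · congr 1; lia
  · intro c
    rcases Int.even_or_odd' c with ⟨k, rfl | rfl⟩
    · exact ⟨.inl k, rfl⟩
    · exact ⟨.inr k, rfl⟩

theorem bijective_rotate :
    Function.Bijective (Sum.elim (fun z : ℤ × ℤ => (z.1 + z.2, z.1 - z.2))
      (fun z : ℤ × ℤ => (-1 - (z.1 + z.2), z.1 - z.2))) := by
  constructor
  · rintro (⟨a, b⟩ | ⟨a, b⟩) (⟨c, d⟩ | ⟨c, d⟩) h <;>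
      simp only [Sum.elim_inl, Sum.elim_inr, Prod.mk.injEq] at h
    · congr 2 <;> lia
    · lia
    · lia
    · congr 2 <;> lia
  · rintro ⟨s, d⟩
    rcases Int.even_or_odd' (s + d) with ⟨k, hk | hk⟩
    · exact ⟨.inl (k, k - d), by simp only [Sum.elim_inl, Prod.mk.injEq]; lia⟩
    · exact ⟨.inr (d - k - 1, -k - 1), by simp only [Sum.elim_inr, Prod.mk.injEq]; lia⟩

theorem neg_one_zpow_mul_exp_mul (n m : ℤ) (u v : ℝ) :
    (-1 : ℝ) ^ n * Real.exp u * ((-1) ^ m * Real.exp v) = (-1) ^ (n + m) * Real.exp (u + v) := by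
  rw [mul_mul_mul_comm, ← zpow_add₀ (by norm_num), ← Real.exp_add]

theorem altTheta_sq_sub_sq {x : ℝ} (hx : 0 < x) :
    altTheta x 1 ^ 2 - altTheta x 3 ^ 2 =
      (∑' n : ℤ, (-1) ^ n * Real.exp (-(x * (4 * n + 1) ^ 2 / 8))) * shiftedTheta (2 * x) 0 := by
  have h1 := summable_norm_altTheta hx (m := 8) (d := 16) (w := 1) (by norm_num) (by norm_num)
  have h3 := summable_norm_altTheta hx (m := 8) (d := 16) (w := 3) (by norm_num) (by norm_num)
  have hE := summable_norm_altTheta hx (m := 4) (d := 8) (w := 1) (by norm_num) (by norm_num)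
  have hT := (summable_exp_neg_sq (mul_pos two_pos hx) 0).norm
  rw [shiftedTheta, tsum_mul_tsum_of_summable_norm hE hT,
    tsum_eq_add_of_bijective_sumElim bijective_rotate (summable_mul_of_summable_norm hE hT),
    altTheta, altTheta, sq, sq, tsum_mul_tsum_of_summable_norm h1 h1,
    tsum_mul_tsum_of_summable_norm h3 h3, sub_eq_add_neg, ← tsum_neg]
  congr 2 <;> ext ⟨n, m⟩ <;> dsimp only
  · rw [neg_one_zpow_mul_exp_mul, mul_assoc, ← Real.exp_add]
    congr 2
    push_cast
    ring
  · rw [neg_one_zpow_mul_exp_mul, mul_assoc, ← Real.exp_add, ← neg_mul]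
    congr 1
    · rw [zpow_sub₀ (by norm_num), zpow_neg_one, inv_neg, inv_one, neg_div, one_div, ← inv_zpow,
        inv_neg, inv_one]
    · congr 1
      push_cast
      ring

theorem two_mul_altTheta_mul {x : ℝ} (hx : 0 < x) :
    2 * (altTheta x 3 * altTheta x 1) =
      shiftedTheta (2 * x) (1 / 2) *
        ∑' n : ℤ, (-1) ^ n * Real.exp (-(x * (4 * n + 1) ^ 2 / 8)) := by
  have h1 := summable_norm_altTheta hx (m := 8) (d := 16) (w := 1) (by norm_num) (by norm_num)
  have h3 := summable_norm_altTheta hx (m := 8) (d := 16) (w := 3) (by norm_num) (by norm_num)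
  have hE := summable_norm_altTheta hx (m := 4) (d := 8) (w := 1) (by norm_num) (by norm_num)
  have hT := (summable_exp_neg_sq (mul_pos two_pos hx) (1 / 2)).norm
  rw [shiftedTheta, tsum_mul_tsum_of_summable_norm hT hE,
    tsum_eq_add_of_bijective_sumElim bijective_rotate (summable_mul_of_summable_norm hT hE),
    altTheta, altTheta, tsum_mul_tsum_of_summable_norm h3 h1, two_mul]
  have hsign : ∀ n m : ℤ, (-1 : ℝ) ^ (n - m) = (-1) ^ (n + m) := fun n m => by
    rw [zpow_sub₀ (by norm_num), zpow_add₀ (by norm_num), div_eq_mul_inv, ← inv_zpow,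
      inv_neg, inv_one]
  congr 2 <;> ext ⟨n, m⟩ <;> dsimp only <;>
  · rw [neg_one_zpow_mul_exp_mul, mul_left_comm, ← Real.exp_add, hsign]
    congr 2
    push_cast
    ring

theorem shiftedTheta_pos {x : ℝ} (hx : 0 < x) (w : ℝ) : 0 < shiftedTheta x w :=
  (summable_exp_neg_sq hx w).tsum_pos (fun _ => (Real.exp_pos _).le) 0 (Real.exp_pos _)

theorem shiftedTheta_div_two {x : ℝ} (hx : 0 < x) :
    shiftedTheta (x / 2) 0 = shiftedTheta (2 * x) 0 + shiftedTheta (2 * x) (1 / 2) := by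
  rw [shiftedTheta, tsum_eq_add_of_bijective_sumElim bijective_even_odd
    (summable_exp_neg_sq (half_pos hx) 0), shiftedTheta, shiftedTheta]
  congr 2 <;> ext n <;> congr 1 <;> push_cast <;> ring

theorem shiftedTheta_inversion {a : ℝ} (ha : 0 < a) :
    shiftedTheta a 0 = √(π / a) * shiftedTheta (π ^ 2 / a) 0 := by
  have h := Real.tsum_exp_neg_mul_int_sq (div_pos ha pi_pos)
  have h1 : ∀ n : ℤ, -π * (a / π) * (n : ℝ) ^ 2 = -(a * (n + 0) ^ 2) := fun n => by
    field_simp; ring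
  have h2 : ∀ n : ℤ, -π / (a / π) * (n : ℝ) ^ 2 = -(π ^ 2 / a * (n + 0) ^ 2) := fun n => by
    field_simp; ring
  simp_rw [h1, h2] at h
  rw [shiftedTheta, h, ← Real.sqrt_eq_rpow, one_div, ← Real.sqrt_inv, inv_div, shiftedTheta]

theorem H_quadratic {x : ℝ} (hx : 0 < x) :
    (1 - H x ^ 2) * shiftedTheta (2 * x) (1 / 2) = 2 * H x * shiftedTheta (2 * x) 0 := by
  obtain ⟨h1, hH⟩ := H_eq_altTheta_div hx
  have e1 := altTheta_sq_sub_sq hx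
  have e2 := two_mul_altTheta_mul hx
  rw [hH]
  field_simp
  linear_combination shiftedTheta (2 * x) (1 / 2) * e1 - shiftedTheta (2 * x) 0 * e2

theorem H_lt_one {x : ℝ} (hx : 0 < x) : H x < 1 := by
  by_contra! h
  have ht := shiftedTheta_pos (mul_pos two_pos hx) 0
  have hs := shiftedTheta_pos (mul_pos two_pos hx) (1 / 2)
  have hl : (1 - H x ^ 2) * shiftedTheta (2 * x) (1 / 2) ≤ 0 :=
    mul_nonpos_of_nonpos_of_nonneg (by nlinarith) hs.le
  have hr : 0 < 2 * H x * shiftedTheta (2 * x) 0 := by positivity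
  exact (hl.trans_lt hr).ne (H_quadratic hx)

theorem shiftedTheta_swap {a b : ℝ} (ha : 0 < a) (hb : 0 < b) (hab : a * b = π ^ 2) :
    ∃ k > 0, shiftedTheta (2 * b) 0 = k * (shiftedTheta (2 * a) 0 + shiftedTheta (2 * a) (1 / 2)) ∧
      shiftedTheta (2 * b) (1 / 2) =
        k * (shiftedTheta (2 * a) 0 - shiftedTheta (2 * a) (1 / 2)) := by
  have e1 := shiftedTheta_inversion (mul_pos two_pos hb)
  have e2 := shiftedTheta_inversion (half_pos hb)
  rw [← hab, show a * b / (2 * b) = a / 2 by field_simp, shiftedTheta_div_two ha] at e1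
  rw [← hab, show a * b / (b / 2) = 2 * a by field_simp, shiftedTheta_div_two hb,
    show π / (b / 2) = 2 ^ 2 * (π / (2 * b)) by field_simp, Real.sqrt_mul (by norm_num),
    Real.sqrt_sq (by norm_num)] at e2
  exact ⟨√(π / (2 * b)), Real.sqrt_pos.2 (by positivity), e1, by linear_combination e2 - e1⟩

end

theorem H_functional_equation (a b : ℝ) (ha : 0 < a) (hb : 0 < b)
    (hab : a * b = π ^ 2) :
    (1 + Real.sqrt 2 + H a) * (1 + Real.sqrt 2 + H b) = 2 * (2 + Real.sqrt 2) := by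
  obtain ⟨k, hk, hc, hs⟩ := shiftedTheta_swap ha hb hab
  have qa := H_quadratic ha
  have qb := H_quadratic hb
  have pa := H_nonneg ha
  have pb := H_nonneg hb
  have sa := shiftedTheta_pos (mul_pos two_pos ha) (1 / 2)
  have la := H_lt_one ha
  have lb := H_lt_one hb
  rw [hc, hs] at qb
  have qb' : (1 - H b ^ 2) * (shiftedTheta (2 * a) 0 - shiftedTheta (2 * a) (1 / 2)) =
      2 * H b * (shiftedTheta (2 * a) 0 + shiftedTheta (2 * a) (1 / 2)) :=
    mul_left_cancel₀ hk.ne' (by linear_combination qb)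
  have hQ : (1 - H a * H b) ^ 2 - (H a + H b) ^ 2 -
      2 * (H a + H b) * (1 - H a * H b) = 0 := by
    refine (mul_eq_zero.1 ?_).resolve_left sa.ne'
    linear_combination (1 - H b ^ 2 - 2 * H b) * qa + 2 * H a * qb'
  have hP : 0 < 1 - H a * H b := by nlinarith
  have h2 : √2 ^ 2 = 2 := Real.sq_sqrt (by norm_num)
  have h1 : 1 < √2 := by nlinarith [Real.sqrt_nonneg 2]
  have hfac : (1 - H a * H b - (1 + √2) * (H a + H b)) *
      (1 - H a * H b + (√2 - 1) * (H a + H b)) = 0 := by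
    linear_combination hQ - (H a + H b) ^ 2 * h2
  have hne : 1 - H a * H b + (√2 - 1) * (H a + H b) ≠ 0 := by
    have := mul_nonneg (sub_pos.2 h1).le (add_nonneg pa pb)
    linarith
  linear_combination h2 - (mul_eq_zero.1 hfac).resolve_right hne
end
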